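/- Let g be a finite-dimensional unimodular Lie algebra of dimension n, ω ∈ g* a closed 1-form and λ a scalar with λω ≠ 0. Then the top cohomology H^n_{λω}(g) with coefficients in the one-dimensional representation ρ_{λω}(ξ) = λω(ξ) vanishes. -/

import Mathlib

set_option linter.unusedSectionVars false

namespace CE

variable (K : Type) [Field K] (L : Type) [LieRing L] [LieAlgebra K L]

/-- A function `(Fin q → L) → K` which is multilinear and alternating:
the underlying predicate of the space of Lie algebra `q`-cochains `Λ^q(𝔤*)`. -/
def IsCochain {q : ℕ} (F : (Fin q → L) → K) : Prop :=
  (∀ (x : Fin q → L) (i : Fin q) (c : K) (u v : L),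
      F (Function.update x i (c • u + v)) =
        c * F (Function.update x i u) + F (Function.update x i v)) ∧
  (∀ (x : Fin q → L) (i j : Fin q), i ≠ j → x i = x j → F x = 0)

/-- The space of `q`-cochains `Λ^q(𝔤*)` as a submodule of all functions. -/
def cochain (q : ℕ) : Submodule K ((Fin q → L) → K) where
  carrier := {F | IsCochain K L F}
  add_mem' := by
    rintro F G ⟨hF1, hF2⟩ ⟨hG1, hG2⟩
    refine ⟨fun x i c u v => ?_, fun x i j hij hx => ?_⟩
    · simp only [Pi.add_apply, hF1, hG1]; ring
    · simp [Pi.add_apply, hF2 x i j hij hx, hG2 x i j hij hx]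
  zero_mem' := ⟨fun x i c u v => by simp, fun x i j h hx => rfl⟩
  smul_mem' := by
    rintro c F ⟨h1, h2⟩
    refine ⟨fun x i a u v => ?_, fun x i j hij hx => ?_⟩
    · simp only [Pi.smul_apply, smul_eq_mul, h1]; ring
    · simp [Pi.smul_apply, h2 x i j hij hx]

variable {K L}

/-- The part of the Chevalley–Eilenberg differential coming from the
(one-dimensional) representation `ρ`:
`Σᵢ (−1)ⁱ ρ(xᵢ) F(x₀,…,x̂ᵢ,…,x_q)`. -/
def term1 (ρ : L →ₗ[K] K) (q : ℕ) (F : (Fin q → L) → K) (x : Fin (q + 1) → L) : K :=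
  ∑ i : Fin (q + 1), (-1 : K) ^ (i : ℕ) * ρ (x i) * F (fun k => x (i.succAbove k))

/-- The part of the Chevalley–Eilenberg differential coming from the Lie bracket;
for alternating multilinear `F` it equals
`Σ_{i<j} (−1)^{i+j} F(⁅xᵢ,xⱼ⁆, x₀, …, x̂ᵢ, …, x̂ⱼ, …, x_q)`, here written by
putting `⁅xᵢ,xⱼ⁆` in the slot of `xⱼ` after deleting `xᵢ`. -/
def term2 (q : ℕ) (F : (Fin q → L) → K) (x : Fin (q + 1) → L) : K :=
  ∑ i : Fin (q + 1), ∑ j : Fin (q + 1),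
    if h : i < j then
      (-1 : K) ^ ((i : ℕ) + 1) *
        F (Function.update (fun k => x (i.succAbove k))
            (j.pred (Fin.ne_zero_of_lt h)) ⁅x i, x j⁆)
    else 0

lemma term1_add (ρ : L →ₗ[K] K) (q : ℕ) (F G : (Fin q → L) → K) (x : Fin (q + 1) → L) :
    term1 ρ q (F + G) x = term1 ρ q F x + term1 ρ q G x := by
  unfold term1
  rw [← Finset.sum_add_distrib]
  exact Finset.sum_congr rfl fun i _ => by simp [mul_add]

lemma term1_smul (ρ : L →ₗ[K] K) (q : ℕ) (c : K) (F : (Fin q → L) → K)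
    (x : Fin (q + 1) → L) : term1 ρ q (c • F) x = c * term1 ρ q F x := by
  unfold term1
  rw [Finset.mul_sum]
  exact Finset.sum_congr rfl fun i _ => by simp; ring

lemma term2_add (q : ℕ) (F G : (Fin q → L) → K) (x : Fin (q + 1) → L) :
    term2 q (F + G) x = term2 q F x + term2 q G x := by
  unfold term2
  rw [← Finset.sum_add_distrib]
  refine Finset.sum_congr rfl fun i _ => ?_
  rw [← Finset.sum_add_distrib]
  refine Finset.sum_congr rfl fun j _ => ?_
  by_cases h : i < j
  · simp [h, mul_add]
  · simp [h]

lemma term2_smul (q : ℕ) (c : K) (F : (Fin q → L) → K) (x : Fin (q + 1) → L) :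
    term2 q (c • F) x = c * term2 q F x := by
  unfold term2
  rw [Finset.mul_sum]
  refine Finset.sum_congr rfl fun i _ => ?_
  rw [Finset.mul_sum]
  refine Finset.sum_congr rfl fun j _ => ?_
  by_cases h : i < j
  · simp [h]; ring
  · simp [h]

variable (K L) in
/-- The Chevalley–Eilenberg differential of the Lie algebra `L` with coefficients in the
one-dimensional representation `ρ : L →ₗ[K] K`, as a linear map on raw functions.
On the alternating multilinear functions (`cochain`) it is the usual differential
`(d f)(x₀,…,x_q) = Σᵢ (−1)ⁱ ρ(xᵢ) f(…,x̂ᵢ,…) + Σ_{i<j} (−1)^{i+j} f(⁅xᵢ,xⱼ⁆,…,x̂ᵢ,…,x̂ⱼ,…)`. -/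
def ceD (ρ : L →ₗ[K] K) (q : ℕ) :
    ((Fin q → L) → K) →ₗ[K] ((Fin (q + 1) → L) → K) where
  toFun F := fun x => term1 ρ q F x + term2 q F x
  map_add' F G := by
    funext x
    simp only [term1_add, term2_add, Pi.add_apply]
    ring
  map_smul' c F := by
    funext x
    simp only [term1_smul, term2_smul, Pi.smul_apply, smul_eq_mul, RingHom.id_apply]
    ring

variable (K L)

/-- Cocycles: alternating multilinear functions killed by the CE differential. -/
def cocycles (ρ : L →ₗ[K] K) (q : ℕ) : Submodule K ((Fin q → L) → K) :=
  cochain K L q ⊓ LinearMap.ker (ceD K L ρ q)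

/-- Coboundaries: images of cochains under the CE differential
(intersected with the cocycles; mathematically the image already consists of cocycles). -/
def coboundaries (ρ : L →ₗ[K] K) : (q : ℕ) → Submodule K ((Fin q → L) → K)
  | 0 => ⊥
  | (q + 1) =>
      (Submodule.map (ceD K L ρ q) (cochain K L q)) ⊓ cocycles K L ρ (q + 1)

/-- The Chevalley–Eilenberg cohomology `H^q(L, K_ρ)` of `L` with coefficients in the
one-dimensional representation `ρ : L →ₗ[K] K` (for `ρ = 0`: trivial coefficients). -/
def cohomology (ρ : L →ₗ[K] K) (q : ℕ) : Type _ :=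
  cocycles K L ρ q ⧸ (coboundaries K L ρ q).comap (cocycles K L ρ q).subtype

instance (ρ : L →ₗ[K] K) (q : ℕ) : AddCommGroup (cohomology K L ρ q) :=
  inferInstanceAs (AddCommGroup (_ ⧸ _))

instance (ρ : L →ₗ[K] K) (q : ℕ) : Module K (cohomology K L ρ q) :=
  inferInstanceAs (Module K (_ ⧸ _))

end CE

/-- The derivation induced by an endomorphism acts on top-degree alternating maps as
multiplication by the trace. -/
theorem AlternatingMap.sum_map_update_eq_trace_mul {R M ι : Type*} [CommRing R] [AddCommGroup M]
    [Module R M] [Fintype ι] [DecidableEq ι] (b : Module.Basis ι R M) (v : M [⋀^ι]→ₗ[R] R)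
    (A : M →ₗ[R] M) (x : ι → M) :
    ∑ i, v (Function.update x i (A (x i))) = LinearMap.trace R M A * v x := by
  have hdet : ∑ i, b.det (Function.update x i (A (x i))) = LinearMap.trace R M A * b.det x := by
    have hcol : ∀ i, (b.repr (A (x i)) : ι → R) =
        (LinearMap.toMatrix b b A * b.toMatrix x).col i := by
      intro i
      rw [← LinearMap.toMatrix_mulVec_repr b b A (x i)]
      rfl
    calc ∑ i, b.det (Function.update x i (A (x i)))
        = ∑ i, ((b.toMatrix x).adjugate *
            (LinearMap.toMatrix b b A * b.toMatrix x)) i i := by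
          refine Finset.sum_congr rfl fun i _ => ?_
          rw [Module.Basis.det_apply, Module.Basis.toMatrix_update, hcol, ← Matrix.cramer_apply,
            Matrix.cramer_eq_adjugate_mulVec]
          rfl
      _ = Matrix.trace ((b.toMatrix x).adjugate *
            (LinearMap.toMatrix b b A * b.toMatrix x)) := rfl
      _ = LinearMap.trace R M A * b.det x := by
          rw [Matrix.trace_mul_comm, Matrix.mul_assoc, Matrix.mul_adjugate, Matrix.mul_smul,
            Matrix.mul_one, Matrix.trace_smul, LinearMap.trace_eq_matrix_trace R b,
            Module.Basis.det_apply, smul_eq_mul, mul_comm]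
  rw [v.eq_smul_basis_det b]
  simp only [AlternatingMap.smul_apply, smul_eq_mul, ← Finset.mul_sum, hdet]
  ring

/-- Summing a symmetric function over all off-diagonal pairs counts each pair `i < j` twice. -/
theorem Finset.sum_sum_ne_eq_two_mul_sum_sum_lt {R ι : Type*} [CommRing R] [Fintype ι]
    [LinearOrder ι] (S : ι → ι → R) (hS : ∀ i j, i ≠ j → S i j = S j i) :
    ∑ i, ∑ j, (if i ≠ j then S i j else 0) = 2 * ∑ i, ∑ j, if i < j then S i j else 0 := by
  have hsplit : ∀ i j, (if i ≠ j then S i j else 0) =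
      (if i < j then S i j else 0) + if j < i then S j i else 0 := by
    intro i j
    rcases lt_trichotomy i j with h | rfl | h
    · simp [h, h.ne, h.not_gt]
    · simp
    · simp [h, h.ne', h.not_gt, hS i j h.ne']
  simp only [hsplit, Finset.sum_add_distrib]
  rw [Finset.sum_comm (f := fun i j => if j < i then S j i else 0), two_mul]

namespace CE

variable {K L : Type} [Field K] [LieRing L] [LieAlgebra K L]

theorem IsCochain.map_zero {q : ℕ} {F : (Fin q → L) → K} (hF : IsCochain K L F)
    (x : Fin q → L) (i : Fin q) : F (Function.update x i 0) = 0 := by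
  simpa using hF.1 x i 1 0 0

/-- A cochain, bundled as an alternating map. -/
def IsCochain.toAlternatingMap {q : ℕ} {F : (Fin q → L) → K} (hF : IsCochain K L F) :
    L [⋀^Fin q]→ₗ[K] K where
  toFun := F
  map_update_add' x i u w := by
    convert hF.1 x i 1 u w using 1
    · congr 1; simp; congr!
    · rw [one_mul]; congr!
  map_update_smul' x i c u := by
    have h := hF.1 x i c u 0
    rw [add_zero, hF.map_zero, add_zero] at h
    convert h using 1
    · congr!
    · rw [smul_eq_mul]; congr!
  map_eq_zero_of_eq' x i j hx hij := hF.2 x i j hij hx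

theorem isCochain_alternatingMap {q : ℕ} (v : L [⋀^Fin q]→ₗ[K] K) : IsCochain K L v :=
  ⟨fun x i c u w => by rw [v.map_update_add, v.map_update_smul, smul_eq_mul],
    fun x i j hij hx => v.map_eq_zero_of_eq x hx hij⟩

theorem neg_one_pow_mul_curryLeft_removeNth {m : ℕ} (v : L [⋀^Fin (m + 1)]→ₗ[K] K) (ξ : L)
    (x : Fin (m + 1) → L) (i : Fin (m + 1)) :
    (-1 : K) ^ (i : ℕ) * v.curryLeft ξ (fun k => x (i.succAbove k)) =
      v (Function.update x i ξ) := by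
  rw [← Fin.insertNth_removeNth, AlternatingMap.map_insertNth, zsmul_eq_mul]
  push_cast
  rfl

theorem term1_curryLeft {m : ℕ} (b : Module.Basis (Fin (m + 1)) K L) (ρ : L →ₗ[K] K)
    (v : L [⋀^Fin (m + 1)]→ₗ[K] K) (ξ : L) (x : Fin (m + 1) → L) :
    term1 ρ m (v.curryLeft ξ) x = ρ ξ * v x := by
  have : Module.Free K L := Module.Free.of_basis b
  have : Module.Finite K L := Module.Finite.of_basis b
  rw [← LinearMap.trace_smulRight ρ ξ, ← v.sum_map_update_eq_trace_mul b]
  refine Finset.sum_congr rfl fun i _ => ?_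
  rw [mul_right_comm, neg_one_pow_mul_curryLeft_removeNth, LinearMap.smulRight_apply,
    v.map_update_smul, smul_eq_mul, mul_comm]

theorem map_update_update_lie_symm {ι : Type*} [DecidableEq ι] (v : L [⋀^ι]→ₗ[K] K) (ξ : L)
    (x : ι → L) {i j : ι} (hij : i ≠ j) :
    v (Function.update (Function.update x j ⁅x i, x j⁆) i ξ) =
      v (Function.update (Function.update x i ⁅x j, x i⁆) j ξ) := by
  rw [← lie_skew (x i) (x j), Function.update_comm hij.symm, ← neg_one_smul K ⁅x j, x i⁆,
    v.map_update_smul, neg_one_smul, ← v.map_swap _ hij]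
  congr 1
  funext k
  by_cases hi : k = i
  · subst hi; simp [hij]
  by_cases hj : k = j
  · subst hj; simp [hij]
  simp [Equiv.swap_apply_of_ne_of_ne hi hj, hi, hj]

theorem term2_curryLeft {m : ℕ} (v : L [⋀^Fin (m + 1)]→ₗ[K] K) (ξ : L) (x : Fin (m + 1) → L) :
    term2 m (v.curryLeft ξ) x = -∑ i, ∑ j,
      if i < j then v (Function.update (Function.update x j ⁅x i, x j⁆) i ξ) else 0 := by
  simp only [term2, ← Finset.sum_neg_distrib]
  refine Finset.sum_congr rfl fun i _ => Finset.sum_congr rfl fun j _ => ?_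
  split_ifs with h
  · have hj : i.succAbove (j.pred (Fin.ne_zero_of_lt h)) = j :=
      Fin.succAbove_pred_of_lt _ _ h
    have hx : Function.update (fun k => x (i.succAbove k)) (j.pred (Fin.ne_zero_of_lt h))
        ⁅x i, x j⁆ = fun k => Function.update x j ⁅x i, x j⁆ (i.succAbove k) :=
      (Fin.removeNth_update_succAbove i _ _ x).symm.trans (by rw [hj]; rfl)
    rw [hx, pow_succ, mul_neg_one, neg_mul, neg_one_pow_mul_curryLeft_removeNth]
  · simp

/-- On a unimodular Lie algebra, contractions of a volume form are closed for trivial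
coefficients. -/
theorem term2_curryLeft_eq_zero [CharZero K] {m : ℕ} (b : Module.Basis (Fin (m + 1)) K L)
    (huni : ∀ x : L, LinearMap.trace K L (LieAlgebra.ad K L x) = 0)
    (v : L [⋀^Fin (m + 1)]→ₗ[K] K) (ξ : L) (x : Fin (m + 1) → L) :
    term2 m (v.curryLeft ξ) x = 0 := by
  have had : ∀ (y : L) (z : Fin (m + 1) → L), ∑ i, v (Function.update z i ⁅y, z i⁆) = 0 := by
    intro y z
    simpa [huni y] using v.sum_map_update_eq_trace_mul b (LieAlgebra.ad K L y) z
  set S : Fin (m + 1) → Fin (m + 1) → K := fun i j =>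
    v (Function.update (Function.update x j ⁅x i, x j⁆) i ξ)
  have hrow : ∀ i, ∑ j, (if i ≠ j then S i j else 0) = v (Function.update x i ⁅ξ, x i⁆) := by
    intro i
    have h := had (x i) (Function.update x i ξ)
    rw [← Finset.add_sum_erase _ _ (Finset.mem_univ i)] at h
    rw [← Finset.add_sum_erase _ _ (Finset.mem_univ i), if_neg (by simp), zero_add,
      ← lie_skew ξ (x i), ← neg_one_smul K ⁅x i, ξ⁆, v.map_update_smul, neg_one_smul]
    rw [Function.update_self, Function.update_idem] at h
    rw [← eq_neg_of_add_eq_zero_right h]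
    refine Finset.sum_congr rfl fun j hj => ?_
    have hji : j ≠ i := Finset.ne_of_mem_erase hj
    rw [if_pos hji.symm, Function.update_of_ne hji, Function.update_comm hji.symm]
  have htwo := Finset.sum_sum_ne_eq_two_mul_sum_sum_lt S
    fun i j hij => map_update_update_lie_symm v ξ x hij
  simp only [hrow, had] at htwo
  rw [term2_curryLeft, neg_eq_zero]
  exact (mul_eq_zero.mp htwo.symm).resolve_left two_ne_zero

end CE

/-- Let `g` be a finite-dimensional unimodular Lie algebra of dimension
`n` over a field of characteristic zero (`trace (ad X) = 0` for all `X`), `ω ∈ g*` a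
nonzero closed 1-form and `λ ≠ 0`. Then the top cohomology `H^n_{λω}(g)` with coefficients
in the one-dimensional representation `ρ_{λω}(ξ) = λ ω(ξ)` vanishes. -/
theorem stmt19 (K L : Type) [Field K] [CharZero K] [LieRing L] [LieAlgebra K L]
    [FiniteDimensional K L]
    (huni : ∀ x : L, LinearMap.trace K L (LieAlgebra.ad K L x) = 0)
    (ω : L →ₗ[K] K) (hclosed : ∀ x y : L, ω ⁅x, y⁆ = 0) (hω : ω ≠ 0)
    (l : K) (hl : l ≠ 0) :
    Subsingleton (CE.cohomology K L (l • ω) (Module.finrank K L)) := by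
  obtain ⟨ξ, hξ⟩ : ∃ ξ, ω ξ ≠ 0 := by
    by_contra! h
    exact hω (LinearMap.ext h)
  have : Nontrivial L := ⟨ξ, 0, by rintro rfl; simp at hξ⟩
  obtain ⟨m, hm⟩ := Nat.exists_eq_succ_of_ne_zero (Module.finrank_pos (R := K) (M := L)).ne'
  rw [hm]
  have b : Module.Basis (Fin (m + 1)) K L := Module.finBasisOfFinrankEq K L hm
  refine Submodule.Quotient.subsingleton_iff.mpr (eq_top_iff.mpr ?_)
  rintro ⟨F, hF⟩ -
  refine ⟨?_, hF⟩
  set v : L [⋀^Fin (m + 1)]→ₗ[K] K := CE.IsCochain.toAlternatingMap hF.1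
  have hρ : (l • ω) ((l * ω ξ)⁻¹ • ξ) = 1 := by
    rw [map_smul, LinearMap.smul_apply, smul_eq_mul, smul_eq_mul]
    exact inv_mul_cancel₀ (mul_ne_zero hl hξ)
  refine ⟨v.curryLeft ((l * ω ξ)⁻¹ • ξ), CE.isCochain_alternatingMap _, ?_⟩
  funext x
  change CE.term1 _ _ _ x + CE.term2 _ _ x = F x
  rw [CE.term1_curryLeft b, CE.term2_curryLeft_eq_zero b huni, hρ, one_mul, add_zero]
  rfl
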